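/- Let k be even, let (c_1,…,c_k) be a P-admissible finite tuple, and assume c_k > r_{k−1} + 1 where r_{k−1} = φ_{k−1}(c_1,…,c_{k−1}). Then the tuple (c_1,…,c_{k−1},c_k−1) is P-admissible and Inf^{P⁻}(c_1…c_k) = Sup^{P⁻}(c_1…c_{k−1}(c_k−1)). -/

import Mathlib

open Filter Finset Topology

/-! `φ` encodes the family of functions: `φ []` is `φ₀` and
`φ [c₁, …, cₙ]` is `φₙ(c₁, …, cₙ)`. Sequences are 0-indexed:
`p 0` is the paper's `p₁`. -/

/-- The list of the first `n` terms of the sequence `p`. -/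
def prefixList (p : ℕ → ℕ) (n : ℕ) : List ℕ :=
  List.ofFn (fun i : Fin n => p i)

/-- A sequence `p` is `P`-admissible if `pₙ ≥ r_{n-1} + 1` for all `n ≥ 1`. -/
def PAdmissibleSeq (φ : List ℕ → ℕ) (p : ℕ → ℕ) : Prop :=
  ∀ n : ℕ, φ (prefixList p n) + 1 ≤ p n

/-- A tuple `(c₁, …, c_k)` (given as the first `k` values of `c`) is `P`-admissible. -/
def PAdmissibleTuple (φ : List ℕ → ℕ) (c : ℕ → ℕ) (k : ℕ) : Prop :=
  ∀ n < k, φ (prefixList c n) + 1 ≤ c n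

/-- `r₀ r₁ ⋯ rₙ` where `rᵢ = φᵢ(p₁, …, pᵢ)`. -/
noncomputable def numer (φ : List ℕ → ℕ) (p : ℕ → ℕ) (n : ℕ) : ℝ :=
  ∏ i ∈ Finset.range (n + 1), (φ (prefixList p i) : ℝ)

/-- `(p₁ − 1)p₁ ⋯ (pₙ − 1)pₙ`. -/
noncomputable def denomBase (p : ℕ → ℕ) (n : ℕ) : ℝ :=
  ∏ j ∈ Finset.range n, (((p j : ℝ) - 1) * (p j : ℝ))

/-- The `P`-value `val_P(p) = Σ_{n=0}^∞ (r₀⋯rₙ)/((p₁−1)p₁⋯(pₙ−1)pₙ·p_{n+1})`. -/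
noncomputable def valP (φ : List ℕ → ℕ) (p : ℕ → ℕ) : ℝ :=
  ∑' n : ℕ, numer φ p n / (denomBase p n * (p n : ℝ))

/-- The `P⁻`-value
`val_{P⁻}(q) = Σ_{n=0}^∞ (−1)ⁿ (r₀⋯rₙ)/((q₁−1)q₁⋯(qₙ−1)qₙ·(q_{n+1}−1))`. -/
noncomputable def valPNeg (φ : List ℕ → ℕ) (q : ℕ → ℕ) : ℝ :=
  ∑' n : ℕ, (-1 : ℝ) ^ n * numer φ q n / (denomBase q n * ((q n : ℝ) - 1))

/-- `Inf^P(c₁…c_k) = Σ_{n=0}^{k−1} (r₀⋯rₙ)/((c₁−1)c₁⋯(cₙ−1)cₙ·c_{n+1})`. -/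
noncomputable def InfP (φ : List ℕ → ℕ) (c : ℕ → ℕ) (k : ℕ) : ℝ :=
  ∑ n ∈ Finset.range k, numer φ c n / (denomBase c n * (c n : ℝ))

/-- The diameter `(r₀⋯r_{k−1})/((c₁−1)c₁⋯(c_k−1)c_k)`. -/
noncomputable def DiamP (φ : List ℕ → ℕ) (c : ℕ → ℕ) (k : ℕ) : ℝ :=
  (∏ i ∈ Finset.range k, (φ (prefixList c i) : ℝ)) / denomBase c k

/-- `Sup^P(c₁…c_k) = Inf^P(c₁…c_k) + (r₀⋯r_{k−1})/((c₁−1)c₁⋯(c_k−1)c_k)`. -/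
noncomputable def SupP (φ : List ℕ → ℕ) (c : ℕ → ℕ) (k : ℕ) : ℝ :=
  InfP φ c k + DiamP φ c k

/-- `A(c₁…c_k) = Σ_{n=0}^{k−1} (−1)ⁿ (r₀⋯rₙ)/((c₁−1)c₁⋯(cₙ−1)cₙ·(c_{n+1}−1))`. -/
noncomputable def APNeg (φ : List ℕ → ℕ) (c : ℕ → ℕ) (k : ℕ) : ℝ :=
  ∑ n ∈ Finset.range k, (-1 : ℝ) ^ n * numer φ c n / (denomBase c n * ((c n : ℝ) - 1))

/-- `Sup^{P⁻}(c₁…c_k)`: `A` if `k` odd, `A + D` if `k` even. -/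
noncomputable def SupPNeg (φ : List ℕ → ℕ) (c : ℕ → ℕ) (k : ℕ) : ℝ :=
  if Odd k then APNeg φ c k else APNeg φ c k + DiamP φ c k

/-- `Inf^{P⁻}(c₁…c_k)`: `A − D` if `k` odd, `A` if `k` even. -/
noncomputable def InfPNeg (φ : List ℕ → ℕ) (c : ℕ → ℕ) (k : ℕ) : ℝ :=
  if Odd k then APNeg φ c k - DiamP φ c k else APNeg φ c k

theorem prefixList_update_of_le (c : ℕ → ℕ) (v : ℕ) {m n : ℕ} (h : n ≤ m) :
    prefixList (Function.update c m v) n = prefixList c n := by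
  unfold prefixList
  congr 1
  funext i
  exact Function.update_of_ne (by omega) _ _

theorem numer_update_of_le (φ : List ℕ → ℕ) (c : ℕ → ℕ) (v : ℕ) {m n : ℕ} (h : n ≤ m) :
    numer φ (Function.update c m v) n = numer φ c n := by
  unfold numer
  refine Finset.prod_congr rfl fun i hi => ?_
  rw [prefixList_update_of_le c v (by have := Finset.mem_range.mp hi; omega)]

theorem denomBase_update_of_le (c : ℕ → ℕ) (v : ℕ) {m n : ℕ} (h : n ≤ m) :
    denomBase (Function.update c m v) n = denomBase c n := by
  unfold denomBase
  refine Finset.prod_congr rfl fun i hi => ?_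
  rw [Function.update_of_ne (by have := Finset.mem_range.mp hi; omega)]

theorem APNeg_update_of_le (φ : List ℕ → ℕ) (c : ℕ → ℕ) (v : ℕ) {m n : ℕ} (h : n ≤ m) :
    APNeg φ (Function.update c m v) n = APNeg φ c n := by
  unfold APNeg
  refine Finset.sum_congr rfl fun i hi => ?_
  have hi' := Finset.mem_range.mp hi
  rw [numer_update_of_le φ c v (by omega), denomBase_update_of_le c v (by omega),
    Function.update_of_ne (by omega)]

theorem APNeg_succ (φ : List ℕ → ℕ) (c : ℕ → ℕ) (m : ℕ) :
    APNeg φ c (m + 1) =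
      APNeg φ c m + (-1 : ℝ) ^ m * numer φ c m / (denomBase c m * ((c m : ℝ) - 1)) :=
  Finset.sum_range_succ _ _

theorem DiamP_succ (φ : List ℕ → ℕ) (c : ℕ → ℕ) (m : ℕ) :
    DiamP φ c (m + 1) =
      numer φ c m / (denomBase c m * (((c m : ℝ) - 1) * (c m : ℝ))) := by
  simp only [DiamP, numer, denomBase, Finset.prod_range_succ _ m]

/-- for even `k` with `c_k > r_{k−1} + 1`,
`Inf^{P⁻}(c₁…c_k) = Sup^{P⁻}(c₁…c_{k−1}(c_k−1))`. -/
theorem stmt16 (φ : List ℕ → ℕ) (hφ : ∀ l, 0 < φ l)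
    (k : ℕ) (hk : Even k) (hk0 : 0 < k)
    (c : ℕ → ℕ) (hc : PAdmissibleTuple φ c k)
    (hck : φ (prefixList c (k - 1)) + 1 < c (k - 1)) :
    PAdmissibleTuple φ (Function.update c (k - 1) (c (k - 1) - 1)) k ∧
      InfPNeg φ c k = SupPNeg φ (Function.update c (k - 1) (c (k - 1) - 1)) k := by
  obtain ⟨m, rfl⟩ : ∃ m, k = m + 1 := ⟨k - 1, by omega⟩
  rw [Nat.add_sub_cancel] at hck ⊢
  have hm : Odd m := by
    rw [← Nat.not_even_iff_odd]
    exact Nat.even_add_one.mp hk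
  refine ⟨fun n hn => ?_, ?_⟩
  · rw [prefixList_update_of_le c _ (Nat.le_of_lt_succ hn)]
    rcases eq_or_ne n m with rfl | hne
    · rw [Function.update_self]
      omega
    · rw [Function.update_of_ne hne]
      exact hc n hn
  · have h3 : 3 ≤ c m := by
      have := hφ (prefixList c m)
      omega
    obtain ⟨d, hd⟩ : ∃ d, c m = d + 3 := ⟨c m - 3, by omega⟩
    rw [InfPNeg, SupPNeg, if_neg (Nat.not_odd_iff_even.mpr hk),
      if_neg (Nat.not_odd_iff_even.mpr hk), APNeg_succ, APNeg_succ, DiamP_succ,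
      APNeg_update_of_le φ c _ le_rfl, numer_update_of_le φ c _ le_rfl,
      denomBase_update_of_le c _ le_rfl, Function.update_self, hm.neg_one_pow, hd,
      show d + 3 - 1 = d + 2 by omega, add_assoc]
    congr 1
    have h1 : (d : ℝ) + 1 ≠ 0 := by positivity
    have h2 : (d : ℝ) + 2 ≠ 0 := by positivity
    push_cast
    rw [show (d : ℝ) + 3 - 1 = d + 2 by ring, show (d : ℝ) + 2 - 1 = d + 1 by ring]
    simp only [div_eq_mul_inv, mul_inv]
    field_simp
    ring
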